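/- arXiv:2008.09044 — 2 statements merged into one kernel-verified Lean document; each statement's English description precedes it below -/
import Mathlib

section
/- Let d ≥ 1 and C > 0. Let u : ℝ^d × ℝ → [0,1] satisfy: (a) |u(p,e) − u(p′,e)| ≤ C|p − p′| for all p, p′ ∈ ℝ^d and e ∈ ℝ; (b) for every p ∈ ℝ^d the map e ↦ u(p,e) is nondecreasing; (c) for every p ∈ ℝ^d, u(p,e) → 0 as e → −∞. Let Γ : ℝ → ℝ be nonincreasing with Γ(𝔢) → −∞ as 𝔢 → +∞ and Γ(𝔢) → +∞ as 𝔢 → −∞, and set Λ(𝔢) := 𝔢 + Γ(𝔢). Define ψ : ℝ^d × ℝ × ℝ → [0,1] by ψ(p,e,𝔢) = u(p,e) if e < Λ(𝔢) and ψ(p,e,𝔢) = 1 if e ≥ Λ(𝔢). Then ψ belongs to the class 𝒦̂; in particular, for each fixed e ∈ ℝ the map (p,𝔢) ↦ ψ(p, e+𝔢, 𝔢) belongs to 𝒦 with Lipschitz constant C. -/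
/-- The class `𝒦` with Lipschitz constant `L`. -/
def MemK (d : ℕ) (L : ℝ) (φ : (Fin d → ℝ) → ℝ → ℝ) : Prop :=
  (∀ (p : Fin d → ℝ) (e : ℝ), φ p e ∈ Set.Icc (0 : ℝ) 1) ∧
  (∀ (p p' : Fin d → ℝ) (e : ℝ), |φ p e - φ p' e| ≤ L * ‖p - p'‖) ∧
  (∀ p : Fin d → ℝ, Monotone (φ p)) ∧
  (∀ p : Fin d → ℝ, (⨆ e : ℝ, φ p e) = 1) ∧
  (∀ p : Fin d → ℝ, (⨅ e : ℝ, φ p e) = 0)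

/-- The class `𝒦̂`: a bounded measurable function `Φ : ℝ^d × ℝ × ℝ → ℝ` such
that (i) for each parameter `𝔢` the map `(p,e) ↦ Φ(p,e,𝔢)` belongs to `𝒦`
with a Lipschitz constant independent of `𝔢`, and (ii) for each `e` the map
`(p,𝔢) ↦ Φ(p, e+𝔢, 𝔢)` belongs to `𝒦`. -/
def MemKhat (d : ℕ) (Φ : (Fin d → ℝ) → ℝ → ℝ → ℝ) : Prop :=
  Measurable (fun x : (Fin d → ℝ) × ℝ × ℝ => Φ x.1 x.2.1 x.2.2) ∧
  (∃ C : ℝ, ∀ (p : Fin d → ℝ) (e fe : ℝ), |Φ p e fe| ≤ C) ∧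
  (∃ LΦ : ℝ, 0 < LΦ ∧ ∀ fe : ℝ, MemK d LΦ (fun p e => Φ p e fe)) ∧
  (∀ e : ℝ, ∃ L' : ℝ, 0 < L' ∧ MemK d L' (fun p fe => Φ p (e + fe) fe))

/-- Replacing `u`, monotone and vanishing at `-∞` in its second variable, by `1` outside a proper
down-closed set that contains a neighbourhood of `-∞` gives a member of `𝒦`. -/
theorem memK_ite_one {d : ℕ} {C : ℝ} (hC : 0 ≤ C) {u : (Fin d → ℝ) → ℝ → ℝ}
    (hub : ∀ p e, u p e ∈ Set.Icc (0 : ℝ) 1)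
    (hulip : ∀ p p' e, |u p e - u p' e| ≤ C * ‖p - p'‖)
    (humono : ∀ p, Monotone (u p))
    (hulim : ∀ p, Filter.Tendsto (u p) Filter.atBot (nhds 0))
    {P : ℝ → Prop} [DecidablePred P] (hP : ∀ ⦃x y⦄, x ≤ y → P y → P x)
    (hbot : ∀ᶠ x in Filter.atBot, P x) (htop : ∃ x, ¬ P x) :
    MemK d C (fun p x => if P x then u p x else 1) := by
  have hmem : ∀ p x, (if P x then u p x else 1) ∈ Set.Icc (0 : ℝ) 1 := by
    intro p x
    split_ifs
    · exact hub p x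
    · simp
  have hmono : ∀ p, Monotone (fun x => if P x then u p x else 1) := by
    intro p x y hxy
    by_cases hy : P y
    · simpa [hy, hP hxy hy] using humono p hxy
    · simpa [hy] using (hmem p x).2
  refine ⟨hmem, fun p p' x => ?_, hmono, fun p => ?_, fun p => ?_⟩
  · dsimp only
    split_ifs
    · exact hulip p p' x
    · simpa using mul_nonneg hC (norm_nonneg (p - p'))
  · obtain ⟨x, hx⟩ := htop
    refine le_antisymm (ciSup_le fun y => (hmem p y).2) ?_
    have h := le_ciSup (f := fun y => if P y then u p y else 1)
      ⟨1, by rintro _ ⟨y, rfl⟩; exact (hmem p y).2⟩ x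
    simpa [hx] using h
  · have hlim : Filter.Tendsto (fun x => if P x then u p x else 1) Filter.atBot (nhds 0) :=
      (hulim p).congr' (hbot.mono fun x hx => (if_pos hx).symm)
    exact tendsto_nhds_unique
      (tendsto_atBot_ciInf (hmono p) ⟨0, by rintro _ ⟨y, rfl⟩; exact (hmem p y).1⟩) hlim

/-- A function Lipschitz in its first and monotone in its second variable is jointly
measurable. -/
theorem measurable_uncurry_of_lipschitz_of_monotone {d : ℕ} {C : ℝ} {u : (Fin d → ℝ) → ℝ → ℝ}
    (hulip : ∀ p p' e, |u p e - u p' e| ≤ C * ‖p - p'‖) (humono : ∀ p, Monotone (u p)) :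
    Measurable (Function.uncurry u) := by
  refine MeasureTheory.measurable_uncurry_of_continuous_of_measurable (fun e => ?_)
    fun p => (humono p).measurable
  refine (LipschitzWith.of_dist_le' (K := C) fun p p' => ?_).continuous
  rw [Real.dist_eq, dist_eq_norm]
  exact hulip p p' e

/-- let `u : ℝ^d × ℝ → [0,1]` be `C`-Lipschitz in `p`,
nondecreasing in `e`, with `u(p,e) → 0` as `e → −∞`.  Let `Γ : ℝ → ℝ` be
nonincreasing with `Γ(𝔢) → −∞` as `𝔢 → +∞` and `Γ(𝔢) → +∞` as `𝔢 → −∞`,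
and put `Λ(𝔢) := 𝔢 + Γ(𝔢)`.  Then `ψ(p,e,𝔢) := u(p,e)` for `e < Λ(𝔢)` and
`1` for `e ≥ Λ(𝔢)` belongs to `𝒦̂`; in particular, for each fixed `e`, the
map `(p,𝔢) ↦ ψ(p, e+𝔢, 𝔢)` belongs to `𝒦` with Lipschitz constant `C`. -/
theorem cutoff_with_cap_mem_Khat (d : ℕ) (hd : 1 ≤ d) (C : ℝ) (hC : 0 < C)
    (u : (Fin d → ℝ) → ℝ → ℝ)
    (hub : ∀ (p : Fin d → ℝ) (e : ℝ), u p e ∈ Set.Icc (0 : ℝ) 1)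
    (hulip : ∀ (p p' : Fin d → ℝ) (e : ℝ), |u p e - u p' e| ≤ C * ‖p - p'‖)
    (humono : ∀ p : Fin d → ℝ, Monotone (u p))
    (hulim : ∀ p : Fin d → ℝ, Filter.Tendsto (u p) Filter.atBot (nhds 0))
    (Γ : ℝ → ℝ) (hΓanti : Antitone Γ)
    (hΓtop : Filter.Tendsto Γ Filter.atTop Filter.atBot)
    (hΓbot : Filter.Tendsto Γ Filter.atBot Filter.atTop) :
    MemKhat d (fun p e fe => if e < fe + Γ fe then u p e else 1) ∧
    (∀ e : ℝ, MemK d C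
      (fun p fe => if e + fe < fe + Γ fe then u p (e + fe) else 1)) := by
  have hfst : ∀ fe : ℝ, MemK d C (fun p e => if e < fe + Γ fe then u p e else 1) := fun fe =>
    memK_ite_one hC.le hub hulip humono hulim (fun _ _ hxy hy => hxy.trans_lt hy)
      (Filter.eventually_lt_atBot _) ⟨fe + Γ fe, lt_irrefl _⟩
  have hsnd : ∀ e : ℝ, MemK d C
      (fun p fe => if e + fe < fe + Γ fe then u p (e + fe) else 1) := by
    intro e
    have hiff : ∀ x : ℝ, e + x < x + Γ x ↔ e < Γ x := fun x => by
      rw [add_comm e x, add_lt_add_iff_left]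
    refine memK_ite_one (u := fun p x => u p (e + x)) hC.le (fun p x => hub p (e + x))
      (fun p p' x => hulip p p' (e + x)) (fun p x y hxy => humono p (by gcongr))
      (fun p => (hulim p).comp (Filter.tendsto_atBot_add_const_left _ e Filter.tendsto_id))
      (fun x y hxy hy => ?_) ?_ ?_
    · rw [hiff] at hy ⊢
      exact hy.trans_le (hΓanti hxy)
    · exact (hΓbot.eventually_gt_atTop e).mono fun x hx => (hiff x).2 hx
    · obtain ⟨x, hx⟩ := (hΓtop.eventually_le_atBot e).exists
      exact ⟨x, fun h => ((hiff x).1 h).not_ge hx⟩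
  refine ⟨⟨?_, ⟨1, fun p e fe => ?_⟩, ⟨C, hC, hfst⟩, fun e => ⟨C, hC, hsnd e⟩⟩, hsnd⟩
  · have hu : Measurable (fun x : (Fin d → ℝ) × ℝ × ℝ => u x.1 x.2.1) :=
      (measurable_uncurry_of_lipschitz_of_monotone hulip humono).comp
        (measurable_fst.prodMk measurable_snd.fst)
    have hΓ : Measurable Γ := hΓanti.measurable
    exact Measurable.ite (measurableSet_lt (by fun_prop) (by fun_prop)) hu measurable_const
  · obtain ⟨h0, h1⟩ := (hfst fe).1 p e
    exact abs_le.2 ⟨by linarith, h1⟩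
end

section
/- Let d ≥ 1, τ > 0, ε ≥ 0 and r ∈ ℝ. Let b : ℝ^d → ℝ^d, σ : ℝ^d → ℝ^{d×d} and μ : ℝ^d × ℝ → ℝ be continuous, set a := σσᵀ, and for a function ϕ(t,p,e) that is C¹ in t and C² in (p,e) write 𝓛_p ϕ := (∂_p ϕ)·b(p) + (1/2)Tr[a(p) ∂²_{pp} ϕ]. Suppose v₁ and v₂ are bounded functions on [0,τ] × ℝ^d × ℝ, C¹ in t and C² in (p,e) with locally bounded derivatives, each solving ∂_t v + μ(p,v) ∂_e v + 𝓛_p v + (ε²/2)(∂²_{ee} v + Δ_{pp} v) = r v on [0,τ] × ℝ^d × ℝ, where Δ_{pp} is the Laplacian in p. Let η : ℝ → ℝ be C² with compact support. Define ρ(t,p) := ∫_ℝ (v₁ − v₂)(t,p,e) η(e) de, M(p,y) := ∫₀^y μ(p,υ) dυ, h(t,p) := ∫_ℝ [M(p, v₁(t,p,e)) − M(p, v₂(t,p,e))] η′(e) de, and g(t,p) := −(ε²/2) ∫_ℝ (v₁ − v₂)(t,p,e) η″(e) de. Then ρ is C¹ in t and C² in p, and satisfies ∂_t ρ + 𝓛_p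 ρ + (ε²/2) Δ_{pp} ρ = r ρ + h + g on [0,τ] × ℝ^d. -/
open MeasureTheory

/-- Partial derivative in time of `u(t,p,e)`. -/
noncomputable def Dt {d : ℕ} (u : ℝ → (Fin d → ℝ) → ℝ → ℝ) :
    ℝ → (Fin d → ℝ) → ℝ → ℝ :=
  fun t p e => deriv (fun s => u s p e) t

/-- Partial derivative in the `e`-variable of `u(t,p,e)`. -/
noncomputable def De {d : ℕ} (u : ℝ → (Fin d → ℝ) → ℝ → ℝ) :
    ℝ → (Fin d → ℝ) → ℝ → ℝ :=
  fun t p e => deriv (fun y => u t p y) e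

/-- Partial derivative in the `i`-th coordinate of the `p`-variable. -/
noncomputable def Dp {d : ℕ} (i : Fin d) (u : ℝ → (Fin d → ℝ) → ℝ → ℝ) :
    ℝ → (Fin d → ℝ) → ℝ → ℝ :=
  fun t p e => deriv (fun x => u t (Function.update p i x) e) (p i)

/-- Time derivative for a function of `(t,p)` only. -/
noncomputable def Dt2 {d : ℕ} (u : ℝ → (Fin d → ℝ) → ℝ) : ℝ → (Fin d → ℝ) → ℝ :=
  fun t p => deriv (fun s => u s p) t

/-- `p_i`-derivative for a function of `(t,p)` only. -/
noncomputable def Dp2 {d : ℕ} (i : Fin d) (u : ℝ → (Fin d → ℝ) → ℝ) :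
    ℝ → (Fin d → ℝ) → ℝ :=
  fun t p => deriv (fun x => u t (Function.update p i x)) (p i)

/-- The quasilinear PDE
`∂_t v + μ(p,v) ∂_e v + 𝓛_p v + (ε²/2)(∂²_ee v + Δ_pp v) = r v`
on `[t₀,t₁] × ℝ^d × ℝ`, where
`𝓛_p v = (∂_p v)·b(p) + ½ Tr[σσᵀ(p) ∂²_pp v]`. -/
def SolvesPDEOn {d : ℕ} (t₀ t₁ ε r : ℝ) (b : (Fin d → ℝ) → Fin d → ℝ)
    (σ : (Fin d → ℝ) → Fin d → Fin d → ℝ) (μ : (Fin d → ℝ) → ℝ → ℝ)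
    (v : ℝ → (Fin d → ℝ) → ℝ → ℝ) : Prop :=
  ∀ t ∈ Set.Icc t₀ t₁, ∀ (p : Fin d → ℝ) (e : ℝ),
    Dt v t p e + μ p (v t p e) * De v t p e
      + (∑ i, b p i * Dp i v t p e)
      + (1 / 2) * (∑ i, ∑ j, (∑ k, σ p i k * σ p j k) * Dp i (Dp j v) t p e)
      + (ε ^ 2 / 2) * (De (De v) t p e + ∑ i, Dp i (Dp i v) t p e)
    = r * v t p e

/-- `v` is C¹ in `t` and C² in `(p,e)`, with (locally bounded, indeed jointly
continuous) derivatives. -/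
def SmoothC1C2 {d : ℕ} (v : ℝ → (Fin d → ℝ) → ℝ → ℝ) : Prop :=
  (∀ (p : Fin d → ℝ) (e : ℝ), Differentiable ℝ (fun t => v t p e)) ∧
  (∀ t : ℝ, ContDiff ℝ 2 (fun q : (Fin d → ℝ) × ℝ => v t q.1 q.2)) ∧
  Continuous (fun x : ℝ × (Fin d → ℝ) × ℝ => v x.1 x.2.1 x.2.2) ∧
  Continuous (fun x : ℝ × (Fin d → ℝ) × ℝ => Dt v x.1 x.2.1 x.2.2) ∧
  Continuous (fun x : ℝ × (Fin d → ℝ) × ℝ => De v x.1 x.2.1 x.2.2) ∧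
  Continuous (fun x : ℝ × (Fin d → ℝ) × ℝ => De (De v) x.1 x.2.1 x.2.2) ∧
  (∀ i : Fin d, Continuous (fun x : ℝ × (Fin d → ℝ) × ℝ => Dp i v x.1 x.2.1 x.2.2)) ∧
  (∀ i j : Fin d,
    Continuous (fun x : ℝ × (Fin d → ℝ) × ℝ => Dp i (Dp j v) x.1 x.2.1 x.2.2))

/-- The `η`-weighted difference `ρ(t,p) = ∫ (v₁ − v₂)(t,p,e) η(e) de`. -/
noncomputable def rhoFun {d : ℕ} (v₁ v₂ : ℝ → (Fin d → ℝ) → ℝ → ℝ) (η : ℝ → ℝ) :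
    ℝ → (Fin d → ℝ) → ℝ :=
  fun t p => ∫ e : ℝ, (v₁ t p e - v₂ t p e) * η e

/-- The antiderivative of the flux: `M(p,y) = ∫₀^y μ(p,υ) dυ`. -/
noncomputable def MFun {d : ℕ} (μ : (Fin d → ℝ) → ℝ → ℝ)
    (p : Fin d → ℝ) (y : ℝ) : ℝ :=
  ∫ υ in (0 : ℝ)..y, μ p υ

/-- The flux source term `h(t,p) = ∫ [M(p,v₁) − M(p,v₂)](t,p,e) η′(e) de`. -/
noncomputable def hFun {d : ℕ} (μ : (Fin d → ℝ) → ℝ → ℝ)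
    (v₁ v₂ : ℝ → (Fin d → ℝ) → ℝ → ℝ) (η : ℝ → ℝ) : ℝ → (Fin d → ℝ) → ℝ :=
  fun t p => ∫ e : ℝ, (MFun μ p (v₁ t p e) - MFun μ p (v₂ t p e)) * deriv η e

/-- The viscosity source term `g(t,p) = −(ε²/2) ∫ (v₁ − v₂)(t,p,e) η″(e) de`. -/
noncomputable def gFun {d : ℕ} (ε : ℝ) (v₁ v₂ : ℝ → (Fin d → ℝ) → ℝ → ℝ)
    (η : ℝ → ℝ) : ℝ → (Fin d → ℝ) → ℝ :=
  fun t p => -(ε ^ 2 / 2) * ∫ e : ℝ, (v₁ t p e - v₂ t p e) * deriv (deriv η) e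

section CompactWeight

variable {f g η : ℝ → ℝ}

lemma integrable_mul_of_hasCompactSupport (hf : Continuous f) (hη : Continuous η)
    (hs : HasCompactSupport η) : Integrable fun e => f e * η e :=
  (hf.mul hη).integrable_of_hasCompactSupport hs.mul_left

/-- Integration by parts against a compactly supported `C¹` weight. -/
lemma integral_deriv_mul_of_hasCompactSupport (hf : ∀ x, HasDerivAt f (g x) x)
    (hg : Continuous g) (hη : ContDiff ℝ 1 η) (hs : HasCompactSupport η) :
    ∫ e, g e * η e = -∫ e, f e * deriv η e := by
  have hfc : Continuous f := continuous_iff_continuousAt.2 fun x => (hf x).continuousAt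
  have hη' : Continuous (deriv η) := hη.continuous_deriv le_rfl
  rw [integral_mul_deriv_eq_deriv_mul_of_integrable (u := f) (u' := g) (v := η) (v' := deriv η)
    (fun x _ => hf x) (fun x _ => (hη.differentiable one_ne_zero x).hasDerivAt)
    (integrable_mul_of_hasCompactSupport hfc hη' hs.deriv)
    (integrable_mul_of_hasCompactSupport hg hη.continuous hs)
    (integrable_mul_of_hasCompactSupport hfc hη.continuous hs), neg_neg]

/-- Differentiation under the integral sign against a compactly supported weight. -/
lemma hasDerivAt_integral_mul_of_hasCompactSupport {F F' : ℝ → ℝ → ℝ}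
    (hF : ∀ x, Continuous (F x)) (hF' : Continuous (Function.uncurry F'))
    (h : ∀ x e, HasDerivAt (fun y => F y e) (F' x e) x)
    (hη : Continuous η) (hs : HasCompactSupport η) (x₀ : ℝ) :
    HasDerivAt (fun x => ∫ e, F x e * η e) (∫ e, F' x₀ e * η e) x₀ := by
  obtain ⟨C, hC⟩ := ((isCompact_closedBall x₀ 1).prod hs).exists_bound_of_continuousOn
    hF'.continuousOn
  have hF'x : Continuous (F' x₀) := hF'.comp (by fun_prop : Continuous fun e => (x₀, e))
  refine (hasDerivAt_integral_of_dominated_loc_of_deriv_le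
    (F := fun x e => F x e * η e) (F' := fun x e => F' x e * η e)
    (bound := fun e => C * ‖η e‖) (Metric.closedBall_mem_nhds x₀ one_pos)
    (.of_forall fun x => ((hF x).mul hη).aestronglyMeasurable)
    (integrable_mul_of_hasCompactSupport (hF x₀) hη hs)
    (hF'x.mul hη).aestronglyMeasurable (.of_forall fun e x hx => ?_)
    ((hη.integrable_of_hasCompactSupport hs).norm.const_mul C)
    (.of_forall fun e x _ => (h x e).mul_const _)).2
  by_cases he : e ∈ tsupport η
  · rw [norm_mul]
    exact mul_le_mul_of_nonneg_right (hC (x, e) ⟨hx, he⟩) (norm_nonneg _)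
  · simp [image_eq_zero_of_notMem_tsupport he]

lemma continuous_integral_mul_of_hasCompactSupport {X : Type*} [TopologicalSpace X]
    [FirstCountableTopology X] {F : X → ℝ → ℝ} (hF : Continuous (Function.uncurry F))
    (hη : Continuous η) (hs : HasCompactSupport η) :
    Continuous fun x => ∫ e, F x e * η e := by
  rw [← continuousOn_univ]
  refine continuousOn_integral_of_compact_support (f := fun x e => F x e * η e) hs ?_ ?_
  · exact (hF.mul (hη.comp continuous_snd)).continuousOn
  · intro x e _ he
    simp [image_eq_zero_of_notMem_tsupport he]

lemma contDiff_integral_mul_of_hasCompactSupport {P : Type*} [NormedAddCommGroup P]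
    [NormedSpace ℝ P] {n : ℕ∞} {F : P → ℝ → ℝ} (hF : ContDiff ℝ n (Function.uncurry F))
    (hη : ContDiff ℝ n η) (hs : HasCompactSupport η) :
    ContDiff ℝ n fun p => ∫ e, F p e * η e := by
  have h := contDiffOn_convolution_left_with_param (μ := volume) (n := n)
    (ContinuousLinearMap.mul ℝ ℝ) (f := fun _ : ℝ => (1 : ℝ)) (g := fun p e => F p e * η e)
    (s := Set.univ) isOpen_univ hs
    (fun p e _ he => by simp [image_eq_zero_of_notMem_tsupport he])
    (continuous_const.locallyIntegrable) (hF.mul (hη.comp contDiff_snd)).contDiffOn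
  rw [Set.univ_prod_univ, contDiffOn_univ] at h
  simpa [convolution, Function.comp_def] using h.comp (contDiff_id.prodMk (contDiff_const (c := 0)))

end CompactWeight

section PartialDerivatives

variable {d : ℕ} {v : ℝ → (Fin d → ℝ) → ℝ → ℝ}

lemma hasDerivAt_Dp {t : ℝ} (h : Differentiable ℝ fun q : (Fin d → ℝ) × ℝ => v t q.1 q.2)
    (i : Fin d) (p : Fin d → ℝ) (e x : ℝ) :
    HasDerivAt (fun y => v t (Function.update p i y) e)
      (Dp i v t (Function.update p i x) e) x := by
  have hd : Differentiable ℝ fun y => v t (Function.update p i y) e :=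
    h.comp (((contDiff_update 1 p i).differentiable one_ne_zero).prodMk
      (differentiable_const e))
  simpa [Dp] using (hd x).hasDerivAt

lemma Dp_eq_fderiv {t : ℝ} (h : Differentiable ℝ fun q : (Fin d → ℝ) × ℝ => v t q.1 q.2)
    (i : Fin d) (p : Fin d → ℝ) (e : ℝ) :
    Dp i v t p e =
      fderiv ℝ (fun q : (Fin d → ℝ) × ℝ => v t q.1 q.2) (p, e) (Pi.single i 1, 0) := by
  have hu : HasDerivAt (fun y => (Function.update p i y, e)) (Pi.single i (1 : ℝ), (0 : ℝ)) (p i) :=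
    (hasDerivAt_update p i (p i)).prodMk (hasDerivAt_const _ e)
  have hv := (h (Function.update p i (p i), e)).hasFDerivAt.comp_hasDerivAt (p i) hu
  rw [Function.update_eq_self] at hv
  exact hv.deriv

lemma contDiff_Dp {t : ℝ} (h : ContDiff ℝ 2 fun q : (Fin d → ℝ) × ℝ => v t q.1 q.2)
    (i : Fin d) : ContDiff ℝ 1 fun q : (Fin d → ℝ) × ℝ => Dp i v t q.1 q.2 := by
  simp only [Dp_eq_fderiv (h.differentiable two_ne_zero)]
  exact (h.fderiv_right (m := 1) (by norm_num)).clm_apply contDiff_const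

lemma contDiff_slice {t : ℝ} (h : ContDiff ℝ 2 fun q : (Fin d → ℝ) × ℝ => v t q.1 q.2)
    (p : Fin d → ℝ) : ContDiff ℝ 2 (v t p) :=
  h.comp (contDiff_const.prodMk contDiff_id)

lemma hasDerivAt_De {t : ℝ} (h : ContDiff ℝ 2 fun q : (Fin d → ℝ) × ℝ => v t q.1 q.2)
    (p : Fin d → ℝ) (e : ℝ) : HasDerivAt (v t p) (De v t p e) e :=
  ((contDiff_slice h p).differentiable two_ne_zero e).hasDerivAt

lemma hasDerivAt_De_De {t : ℝ} (h : ContDiff ℝ 2 fun q : (Fin d → ℝ) × ℝ => v t q.1 q.2)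
    (p : Fin d → ℝ) (e : ℝ) : HasDerivAt (De v t p) (De (De v) t p e) e :=
  (((contDiff_slice h p).differentiable_deriv_two) e).hasDerivAt

lemma Dt2_sub {R₁ R₂ : ℝ → (Fin d → ℝ) → ℝ} {t : ℝ} {p : Fin d → ℝ}
    (h₁ : DifferentiableAt ℝ (fun s => R₁ s p) t) (h₂ : DifferentiableAt ℝ (fun s => R₂ s p) t) :
    Dt2 (R₁ - R₂) t p = Dt2 R₁ t p - Dt2 R₂ t p :=
  deriv_sub h₁ h₂

lemma Dp2_sub {R₁ R₂ : ℝ → (Fin d → ℝ) → ℝ} (h₁ : ∀ t, Differentiable ℝ (R₁ t))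
    (h₂ : ∀ t, Differentiable ℝ (R₂ t)) (i : Fin d) :
    Dp2 i (R₁ - R₂) = Dp2 i R₁ - Dp2 i R₂ := by
  have hu (p : Fin d → ℝ) : Differentiable ℝ (Function.update p i) :=
    (contDiff_update 1 p i).differentiable one_ne_zero
  ext t p
  exact deriv_sub (((h₁ t).comp (hu p)) (p i)) (((h₂ t).comp (hu p)) (p i))

end PartialDerivatives

lemma hasDerivAt_MFun {d : ℕ} {μ : (Fin d → ℝ) → ℝ → ℝ}
    (hμ : Continuous (fun q : (Fin d → ℝ) × ℝ => μ q.1 q.2)) (p : Fin d → ℝ) (y : ℝ) :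
    HasDerivAt (MFun μ p) (μ p y) y :=
  ((hμ.comp (Continuous.prodMk_right p)).integral_hasStrictDerivAt 0 y).hasDerivAt

/-- The `η`-weighted integral of `v(t,p,·)`. -/
noncomputable def weightedIntegral {d : ℕ} (η : ℝ → ℝ) (v : ℝ → (Fin d → ℝ) → ℝ → ℝ) :
    ℝ → (Fin d → ℝ) → ℝ :=
  fun t p => ∫ e : ℝ, v t p e * η e

section WeightedIntegral

variable {d : ℕ} {v : ℝ → (Fin d → ℝ) → ℝ → ℝ} {η : ℝ → ℝ}

lemma hasDerivAt_weightedIntegral_time (hv : SmoothC1C2 v) (hη : Continuous η)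
    (hs : HasCompactSupport η) (t : ℝ) (p : Fin d → ℝ) :
    HasDerivAt (fun s => weightedIntegral η v s p) (weightedIntegral η (Dt v) t p) t := by
  obtain ⟨hdt, -, hc, hct, -⟩ := hv
  exact hasDerivAt_integral_mul_of_hasCompactSupport (F := fun s e => v s p e)
    (F' := fun s e => Dt v s p e)
    (fun s => hc.comp (by fun_prop : Continuous fun e : ℝ => (s, p, e)))
    (hct.comp (by fun_prop : Continuous fun x : ℝ × ℝ => (x.1, p, x.2)))
    (fun s e => (hdt p e s).hasDerivAt) hη hs t

lemma contDiff_weightedIntegral_time (hv : SmoothC1C2 v) (hη : Continuous η)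
    (hs : HasCompactSupport η) (p : Fin d → ℝ) :
    ContDiff ℝ 1 fun t => weightedIntegral η v t p := by
  have hd := fun t => hasDerivAt_weightedIntegral_time hv hη hs t p
  rw [contDiff_one_iff_deriv]
  refine ⟨fun t => (hd t).differentiableAt, ?_⟩
  rw [funext fun t => (hd t).deriv]
  exact continuous_integral_mul_of_hasCompactSupport (F := fun t e => Dt v t p e)
    (hv.2.2.2.1.comp (by fun_prop : Continuous fun x : ℝ × ℝ => (x.1, p, x.2))) hη hs

lemma contDiff_weightedIntegral_space {n : ℕ∞} {t : ℝ}
    (hv : ContDiff ℝ n fun q : (Fin d → ℝ) × ℝ => v t q.1 q.2)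
    (hη : ContDiff ℝ n η) (hs : HasCompactSupport η) :
    ContDiff ℝ n (weightedIntegral η v t) :=
  contDiff_integral_mul_of_hasCompactSupport hv hη hs

lemma Dp2_weightedIntegral (hv : ∀ t, ContDiff ℝ 1 fun q : (Fin d → ℝ) × ℝ => v t q.1 q.2)
    (i : Fin d) (hvi : Continuous fun x : ℝ × (Fin d → ℝ) × ℝ => Dp i v x.1 x.2.1 x.2.2)
    (hη : Continuous η) (hs : HasCompactSupport η) :
    Dp2 i (weightedIntegral η v) = weightedIntegral η (Dp i v) := by
  ext t p
  have h := hasDerivAt_integral_mul_of_hasCompactSupport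
    (F := fun x e => v t (Function.update p i x) e)
    (F' := fun x e => Dp i v t (Function.update p i x) e)
    (fun x => (hv t).continuous.comp (Continuous.prodMk_right _))
    (hvi.comp (by fun_prop : Continuous fun x : ℝ × ℝ => (t, Function.update p i x.1, x.2)))
    (fun x e => hasDerivAt_Dp ((hv t).differentiable one_ne_zero) i p e x) hη hs (p i)
  simpa [weightedIntegral, Dp2] using h.deriv

lemma Dp2_Dp2_weightedIntegral (hv : SmoothC1C2 v) (i j : Fin d) (hη : Continuous η)
    (hs : HasCompactSupport η) :
    Dp2 i (Dp2 j (weightedIntegral η v)) = weightedIntegral η (Dp i (Dp j v)) := by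
  obtain ⟨-, h2, -, -, -, -, hi, hij⟩ := hv
  rw [Dp2_weightedIntegral (fun t => (h2 t).of_le one_le_two) j (hi j) hη hs,
    Dp2_weightedIntegral (fun t => contDiff_Dp (h2 t) j) i (hij i j) hη hs]

/-- The linear equation satisfied by the `η`-weighted integral of a solution of the quasilinear
equation. -/
lemma weightedIntegral_pde {t₀ t₁ ε r : ℝ} {b : (Fin d → ℝ) → Fin d → ℝ}
    {σ : (Fin d → ℝ) → Fin d → Fin d → ℝ} {μ : (Fin d → ℝ) → ℝ → ℝ}
    (hμ : Continuous (fun q : (Fin d → ℝ) × ℝ => μ q.1 q.2))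
    (hv : SmoothC1C2 v) (hpde : SolvesPDEOn t₀ t₁ ε r b σ μ v)
    (hη : ContDiff ℝ 2 η) (hs : HasCompactSupport η) {t : ℝ} (ht : t ∈ Set.Icc t₀ t₁)
    (p : Fin d → ℝ) :
    Dt2 (weightedIntegral η v) t p
        + (∑ i, b p i * Dp2 i (weightedIntegral η v) t p)
        + (1 / 2) * (∑ i, ∑ j,
            (∑ k, σ p i k * σ p j k) * Dp2 i (Dp2 j (weightedIntegral η v)) t p)
        + (ε ^ 2 / 2) * (∑ i, Dp2 i (Dp2 i (weightedIntegral η v)) t p)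
      = r * weightedIntegral η v t p + (∫ e, MFun μ p (v t p e) * deriv η e)
        - (ε ^ 2 / 2) * ∫ e, v t p e * deriv (deriv η) e := by
  have hηc := hη.continuous
  have hη1 : ContDiff ℝ 1 η := hη.of_le one_le_two
  have hη' : ContDiff ℝ 1 (deriv η) := by
    have := (contDiff_succ_iff_deriv (n := 1)).1 (by simpa [one_add_one_eq_two] using hη)
    exact this.2.2
  have hDt : Dt2 (weightedIntegral η v) t p = weightedIntegral η (Dt v) t p :=
    (hasDerivAt_weightedIntegral_time hv hηc hs t p).deriv
  have hDp (i : Fin d) : Dp2 i (weightedIntegral η v) = weightedIntegral η (Dp i v) :=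
    Dp2_weightedIntegral (fun t => (hv.2.1 t).of_le one_le_two) i (hv.2.2.2.2.2.2.1 i) hηc hs
  simp only [Dp2_Dp2_weightedIntegral hv _ _ hηc hs]
  simp only [hDp, hDt]
  obtain ⟨-, h2, hc, hct, hce, hcee, hci, hcij⟩ := hv
  have hline : Continuous fun e : ℝ => (t, p, e) := by fun_prop
  have hMv (e : ℝ) : HasDerivAt (fun e => MFun μ p (v t p e))
      (μ p (v t p e) * De v t p e) e :=
    (hasDerivAt_MFun hμ p _).comp e (hasDerivAt_De (h2 t) p e)
  have hflux : Continuous fun e => μ p (v t p e) * De v t p e :=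
    (hμ.comp (continuous_const.prodMk (hc.comp hline))).mul (hce.comp hline)
  have hM := integral_deriv_mul_of_hasCompactSupport hMv hflux hη1 hs
  have hE := integral_deriv_mul_of_hasCompactSupport (hasDerivAt_De_De (h2 t) p)
    (hcee.comp hline) hη1 hs
  rw [integral_deriv_mul_of_hasCompactSupport (hasDerivAt_De (h2 t) p)
    (hce.comp hline) hη' hs.deriv, neg_neg] at hE
  have key {u : ℝ → ℝ} (hu : Continuous u) := integrable_mul_of_hasCompactSupport hu hηc hs
  have it := key (hct.comp hline)
  have iM := key hflux
  have iE := key (hcee.comp hline)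
  have ii (i : Fin d) := key ((hci i).comp hline)
  have iij (i j : Fin d) := key ((hcij i j).comp hline)
  simp only [Function.comp_def] at it iE ii iij
  have hint : ∫ e, (Dt v t p e * η e + μ p (v t p e) * De v t p e * η e
      + (∑ i, b p i * (Dp i v t p e * η e))
      + (1 / 2) * (∑ i, ∑ j, (∑ k, σ p i k * σ p j k) * (Dp i (Dp j v) t p e * η e))
      + (ε ^ 2 / 2) * (De (De v) t p e * η e + ∑ i, Dp i (Dp i v) t p e * η e))
      = ∫ e, r * (v t p e * η e) := by
    congr 1 with e
    have h := congrArg (· * η e) (hpde t ht p e)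
    simp only [add_mul, mul_assoc, Finset.sum_mul] at h ⊢
    linarith
  have i1 : Integrable fun e => ∑ i, b p i * (Dp i v t p e * η e) :=
    integrable_finsetSum _ fun i _ => (ii i).const_mul _
  have i2 (i : Fin d) : Integrable fun e =>
      ∑ j, (∑ k, σ p i k * σ p j k) * (Dp i (Dp j v) t p e * η e) :=
    integrable_finsetSum _ fun j _ => (iij i j).const_mul _
  have i3 : Integrable fun e => ∑ i, Dp i (Dp i v) t p e * η e :=
    integrable_finsetSum _ fun i _ => iij i i
  have i23 : Integrable fun e => (1 / 2 : ℝ) *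
      ∑ i, ∑ j, (∑ k, σ p i k * σ p j k) * (Dp i (Dp j v) t p e * η e) :=
    (integrable_finsetSum _ fun i _ => i2 i).const_mul _
  rw [integral_add (((it.fun_add iM).fun_add i1).fun_add i23) ((iE.fun_add i3).const_mul _),
    integral_add ((it.fun_add iM).fun_add i1) i23, integral_add (it.fun_add iM) i1,
    integral_add it iM, integral_finsetSum _ fun i _ => (ii i).const_mul _,
    integral_const_mul, integral_finsetSum _ fun i _ => i2 i,
    integral_const_mul, integral_add iE i3, integral_finsetSum _ fun i _ => iij i i,
    integral_const_mul, hM, hE] at hint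
  simp only [integral_finsetSum _ fun j _ => (iij _ j).const_mul _, integral_const_mul] at hint
  simp only [weightedIntegral]
  linarith

end WeightedIntegral

/-- if `v₁`, `v₂` are bounded classical solutions of the viscous
quasilinear PDE and `η` is C² with compact support, then
`ρ(t,p) = ∫ (v₁−v₂)(t,p,e) η(e) de` is C¹ in `t`, C² in `p`, and satisfies the
linear PDE `∂_t ρ + 𝓛_p ρ + (ε²/2) Δ_pp ρ = r ρ + h + g` on `[0,τ] × ℝ^d`. -/
theorem weighted_difference_pde (d : ℕ) (hd : 1 ≤ d) (τ ε r : ℝ)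
    (hτ : 0 < τ) (hε : 0 ≤ ε)
    (b : (Fin d → ℝ) → Fin d → ℝ) (σ : (Fin d → ℝ) → Fin d → Fin d → ℝ)
    (μ : (Fin d → ℝ) → ℝ → ℝ)
    (hb : Continuous b) (hσ : Continuous σ)
    (hμ : Continuous (fun q : (Fin d → ℝ) × ℝ => μ q.1 q.2))
    (v₁ v₂ : ℝ → (Fin d → ℝ) → ℝ → ℝ)
    (hbd₁ : ∃ C : ℝ, ∀ t p e, |v₁ t p e| ≤ C)
    (hbd₂ : ∃ C : ℝ, ∀ t p e, |v₂ t p e| ≤ C)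
    (hsm₁ : SmoothC1C2 v₁) (hsm₂ : SmoothC1C2 v₂)
    (hpde₁ : SolvesPDEOn 0 τ ε r b σ μ v₁)
    (hpde₂ : SolvesPDEOn 0 τ ε r b σ μ v₂)
    (η : ℝ → ℝ) (hη : ContDiff ℝ 2 η) (hηsupp : HasCompactSupport η) :
    (∀ p : Fin d → ℝ, ContDiff ℝ 1 (fun t => rhoFun v₁ v₂ η t p)) ∧
    (∀ t : ℝ, ContDiff ℝ 2 (fun p => rhoFun v₁ v₂ η t p)) ∧
    (∀ t ∈ Set.Icc (0 : ℝ) τ, ∀ p : Fin d → ℝ,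
      Dt2 (rhoFun v₁ v₂ η) t p
        + (∑ i, b p i * Dp2 i (rhoFun v₁ v₂ η) t p)
        + (1 / 2) * (∑ i, ∑ j,
            (∑ k, σ p i k * σ p j k) * Dp2 i (Dp2 j (rhoFun v₁ v₂ η)) t p)
        + (ε ^ 2 / 2) * (∑ i, Dp2 i (Dp2 i (rhoFun v₁ v₂ η)) t p)
      = r * rhoFun v₁ v₂ η t p + hFun μ v₁ v₂ η t p + gFun ε v₁ v₂ η t p) := by
  have hη0 := hη.continuous
  have hη' : Continuous (deriv η) := hη.continuous_deriv one_le_two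
  have hη'' : Continuous (deriv (deriv η)) :=
    ((contDiff_succ_iff_deriv (n := 1)).1 (by simpa [one_add_one_eq_two] using hη)).2.2
      |>.continuous_deriv le_rfl
  have slice {v : ℝ → (Fin d → ℝ) → ℝ → ℝ} (hv : SmoothC1C2 v) (t : ℝ) (p : Fin d → ℝ) :
      Continuous (v t p) := (contDiff_slice (hv.2.1 t) p).continuous
  have hρ : rhoFun v₁ v₂ η = weightedIntegral η v₁ - weightedIntegral η v₂ := by
    ext t p
    simp only [rhoFun, sub_mul]
    exact integral_sub (integrable_mul_of_hasCompactSupport (slice hsm₁ t p) hη0 hηsupp)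
      (integrable_mul_of_hasCompactSupport (slice hsm₂ t p) hη0 hηsupp)
  have time {v : ℝ → (Fin d → ℝ) → ℝ → ℝ} (hv : SmoothC1C2 v) (p : Fin d → ℝ) :=
    contDiff_weightedIntegral_time hv hη0 hηsupp p
  have space {v : ℝ → (Fin d → ℝ) → ℝ → ℝ} (hv : SmoothC1C2 v) (t : ℝ) :
      ContDiff ℝ 2 (weightedIntegral η v t) :=
    contDiff_weightedIntegral_space (n := 2) (hv.2.1 t) hη hηsupp
  have space' {v : ℝ → (Fin d → ℝ) → ℝ → ℝ} (hv : SmoothC1C2 v) (i : Fin d) (t : ℝ) :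
      Differentiable ℝ (Dp2 i (weightedIntegral η v) t) := by
    rw [Dp2_weightedIntegral (fun t => (hv.2.1 t).of_le one_le_two) i (hv.2.2.2.2.2.2.1 i)
      hη0 hηsupp]
    exact (contDiff_weightedIntegral_space (n := 1) (contDiff_Dp (hv.2.1 t) i)
      (hη.of_le one_le_two) hηsupp).differentiable one_ne_zero
  rw [hρ]
  refine ⟨fun p => (time hsm₁ p).sub (time hsm₂ p),
    fun t => (space hsm₁ t).sub (space hsm₂ t), fun t ht p => ?_⟩
  have hDp (i : Fin d) := Dp2_sub (fun t => (space hsm₁ t).differentiable two_ne_zero)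
    (fun t => (space hsm₂ t).differentiable two_ne_zero) i
  have hDpp (i j : Fin d) := Dp2_sub (space' hsm₁ j) (space' hsm₂ j) i
  have contM {v : ℝ → (Fin d → ℝ) → ℝ → ℝ} (hv : SmoothC1C2 v) :
      Continuous fun e => MFun μ p (v t p e) :=
    (continuous_iff_continuousAt.2 fun y => (hasDerivAt_MFun hμ p y).continuousAt).comp
      (slice hv t p)
  have hh : hFun μ v₁ v₂ η t p = (∫ e, MFun μ p (v₁ t p e) * deriv η e)
      - ∫ e, MFun μ p (v₂ t p e) * deriv η e := by
    simp only [hFun, sub_mul]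
    exact integral_sub (integrable_mul_of_hasCompactSupport (contM hsm₁) hη' hηsupp.deriv)
      (integrable_mul_of_hasCompactSupport (contM hsm₂) hη' hηsupp.deriv)
  have hg : gFun ε v₁ v₂ η t p = -(ε ^ 2 / 2) * ((∫ e, v₁ t p e * deriv (deriv η) e)
      - ∫ e, v₂ t p e * deriv (deriv η) e) := by
    simp only [gFun, sub_mul]
    congr 1
    exact integral_sub
      (integrable_mul_of_hasCompactSupport (slice hsm₁ t p) hη'' hηsupp.deriv.deriv)
      (integrable_mul_of_hasCompactSupport (slice hsm₂ t p) hη'' hηsupp.deriv.deriv)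
  have e₁ := weightedIntegral_pde hμ hsm₁ hpde₁ hη hηsupp ht p
  have e₂ := weightedIntegral_pde hμ hsm₂ hpde₂ hη hηsupp ht p
  rw [hh, hg, Dt2_sub ((time hsm₁ p).differentiable one_ne_zero t)
    ((time hsm₂ p).differentiable one_ne_zero t)]
  simp only [hDp, hDpp, Pi.sub_apply, mul_sub, Finset.sum_sub_distrib]
  linarith
end
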